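/- arXiv:1705.01731 — 2 statements merged into one kernel-verified Lean document; each statement's English description precedes it below -/
import Mathlib

section
/- Let N be a finite type with at least two elements, and let φ be an index on N satisfying anonymity and efficiency. If c is a credit function on N such that c(S) = 0 for every nonempty proper subset S of N (so that only the grand coalition N can have positive worth), then φ_i(c) = c(N)/|N| for every i ∈ N; in particular φ agrees with the e-index on such credit functions. -/
/-- A credit function on `N`: assigns a nonnegative worth to each group of
authors, with the empty group getting worth `0`. -/
def IsCredit {N : Type*} [Fintype N] [DecidableEq N] (c : Finset N → ℝ) : Prop :=
  c ∅ = 0 ∧ ∀ S : Finset N, 0 ≤ c S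

/-- The e-index: `e_i(c) = Σ_{S ⊆ N, i ∈ S} c(S)/|S|`. -/
noncomputable def eIndex {N : Type*} [Fintype N] [DecidableEq N]
    (c : Finset N → ℝ) (i : N) : ℝ :=
  ∑ S ∈ Finset.univ.powerset.filter (fun S => i ∈ S), c S / (S.card : ℝ)

/-- The permuted credit function: `(πc)(T) = c(π⁻¹(T))`. -/
def permCredit {N : Type*} [Fintype N] [DecidableEq N]
    (π : Equiv.Perm N) (c : Finset N → ℝ) : Finset N → ℝ :=
  fun T => c (T.image π.symm)

/-- Anonymity: `φ_{π(i)}(πc) = φ_i(c)` for every permutation `π`,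
credit function `c`, and author `i`. -/
def Anonymity {N : Type*} [Fintype N] [DecidableEq N]
    (φ : (Finset N → ℝ) → N → ℝ) : Prop :=
  ∀ π : Equiv.Perm N, ∀ c : Finset N → ℝ, IsCredit c →
    ∀ i : N, φ (permCredit π c) (π i) = φ c i

/-- Monotonicity: if `c(S ∪ {i}) ≥ d(S ∪ {i})` for all `S ⊆ N \ {i}`,
then `φ_i(c) ≥ φ_i(d)`. -/
def Monotonicity {N : Type*} [Fintype N] [DecidableEq N]
    (φ : (Finset N → ℝ) → N → ℝ) : Prop :=
  ∀ c d : Finset N → ℝ, IsCredit c → IsCredit d → ∀ i : N,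
    (∀ S : Finset N, i ∉ S → d (insert i S) ≤ c (insert i S)) →
    φ d i ≤ φ c i

/-- Efficiency: `Σ_{i ∈ N} φ_i(c) = Σ_{S ⊆ N, S nonempty} c(S)`. -/
def Efficiency {N : Type*} [Fintype N] [DecidableEq N]
    (φ : (Finset N → ℝ) → N → ℝ) : Prop :=
  ∀ c : Finset N → ℝ, IsCredit c →
    ∑ i : N, φ c i = ∑ S ∈ Finset.univ.powerset.filter (fun S => S.Nonempty), c S

theorem permCredit_eq_self_of_forall_proper_eq_zero {N : Type*} [Fintype N] [DecidableEq N]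
    {c : Finset N → ℝ}
    (hzero : ∀ S : Finset N, S.Nonempty → S ≠ Finset.univ → c S = 0) (π : Equiv.Perm N) :
    permCredit π c = c := by
  funext T
  rcases T.eq_empty_or_nonempty with rfl | hT
  · simp [permCredit]
  by_cases hu : T = Finset.univ
  · subst hu
    rw [permCredit, Finset.image_univ_equiv]
  · rw [hzero T hT hu]
    refine hzero _ (hT.image _) fun h => hu ?_
    rwa [← Finset.card_eq_iff_eq_univ, Finset.card_image_of_injective _ π.symm.injective,
      Finset.card_eq_iff_eq_univ] at h

theorem eIndex_eq_of_forall_proper_eq_zero {N : Type*} [Fintype N] [DecidableEq N]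
    {c : Finset N → ℝ}
    (hzero : ∀ S : Finset N, S.Nonempty → S ≠ Finset.univ → c S = 0) (i : N) :
    eIndex c i = c Finset.univ / (Fintype.card N : ℝ) := by
  rw [eIndex, Finset.sum_eq_single Finset.univ, Finset.card_univ]
  · intro S hS hu
    rw [hzero S ⟨i, (Finset.mem_filter.mp hS).2⟩ hu, zero_div]
  · simp

theorem Efficiency.sum_eq_of_forall_proper_eq_zero {N : Type*} [Fintype N] [DecidableEq N]
    [Nonempty N] {φ : (Finset N → ℝ) → N → ℝ} (heff : Efficiency φ)
    {c : Finset N → ℝ} (hc : IsCredit c)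
    (hzero : ∀ S : Finset N, S.Nonempty → S ≠ Finset.univ → c S = 0) :
    ∑ i : N, φ c i = c Finset.univ := by
  rw [heff c hc, Finset.sum_eq_single Finset.univ]
  · exact fun S hS hu => hzero S (Finset.mem_filter.mp hS).2 hu
  · simp [Finset.univ_nonempty]

theorem Anonymity.apply_eq_of_forall_proper_eq_zero {N : Type*} [Fintype N] [DecidableEq N]
    {φ : (Finset N → ℝ) → N → ℝ} (hanon : Anonymity φ)
    {c : Finset N → ℝ} (hc : IsCredit c)
    (hzero : ∀ S : Finset N, S.Nonempty → S ≠ Finset.univ → c S = 0) (i j : N) :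
    φ c j = φ c i := by
  simpa [permCredit_eq_self_of_forall_proper_eq_zero hzero] using
    hanon (Equiv.swap i j) c hc i

/-- If `φ` satisfies anonymity and efficiency and `c` vanishes on every nonempty
proper subset of `N`, then `φ_i(c) = c(N)/|N|` for all `i`; in particular `φ`
agrees with the e-index on such credit functions. -/
theorem index_on_grand_coalition_credit {N : Type*} [Fintype N] [DecidableEq N] [Nontrivial N]
    (φ : (Finset N → ℝ) → N → ℝ)
    (hanon : Anonymity φ) (heff : Efficiency φ)
    (c : Finset N → ℝ) (hc : IsCredit c)
    (hzero : ∀ S : Finset N, S.Nonempty → S ≠ Finset.univ → c S = 0) (i : N) :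
    φ c i = c Finset.univ / (Fintype.card N : ℝ) ∧ φ c i = eIndex c i := by
  have h : φ c i = c Finset.univ / (Fintype.card N : ℝ) := by
    rw [eq_div_iff (Nat.cast_ne_zero.mpr Fintype.card_ne_zero),
      ← heff.sum_eq_of_forall_proper_eq_zero hc hzero,
      Finset.sum_congr rfl fun j _ => hanon.apply_eq_of_forall_proper_eq_zero hc hzero i j]
    simp [mul_comm]
  exact ⟨h, h.trans (eIndex_eq_of_forall_proper_eq_zero hzero i).symm⟩
end

section
/- Let N be a finite type with at least two elements, and let φ be an index on N satisfying anonymity, monotonicity, and efficiency. Then φ is the e-index: for every credit function c on N and every i ∈ N, φ_i(c) = Σ_{S ⊆ N, i ∈ S} c(S)/|S|. -/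
theorem eIndex_eq_sum_ite {N : Type*} [Fintype N] [DecidableEq N]
    (c : Finset N → ℝ) (i : N) :
    eIndex c i = ∑ S : Finset N, if i ∈ S then c S / (S.card : ℝ) else 0 := by
  rw [eIndex, Finset.sum_filter, Finset.powerset_univ]

/-- The e-index is efficient. -/
theorem efficiency_eIndex {N : Type*} [Fintype N] [DecidableEq N] :
    Efficiency (eIndex : (Finset N → ℝ) → N → ℝ) := by
  intro c _
  simp only [eIndex_eq_sum_ite]
  rw [Finset.sum_comm, Finset.sum_filter, Finset.powerset_univ]
  refine Finset.sum_congr rfl fun S _ => ?_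
  rw [Finset.sum_ite_mem, Finset.univ_inter, Finset.sum_const, nsmul_eq_mul]
  split_ifs with hS
  · have : (S.card : ℝ) ≠ 0 := by exact_mod_cast hS.card_pos.ne'
    field_simp
  · simp [Finset.not_nonempty_iff_eq_empty.mp hS]

/-- A monotone index gives `i` a value that depends only on the groups containing `i`. -/
theorem Monotonicity.congr {N : Type*} [Fintype N] [DecidableEq N]
    {φ : (Finset N → ℝ) → N → ℝ} (hmono : Monotonicity φ) {c d : Finset N → ℝ}
    (hc : IsCredit c) (hd : IsCredit d) {i : N} (h : ∀ S, i ∈ S → c S = d S) :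
    φ c i = φ d i :=
  le_antisymm
    (hmono d c hd hc i fun S _ => (h _ (Finset.mem_insert_self i S)).le)
    (hmono c d hc hd i fun S _ => (h _ (Finset.mem_insert_self i S)).ge)

theorem eIndex_congr {N : Type*} [Fintype N] [DecidableEq N]
    {c d : Finset N → ℝ} {i : N} (h : ∀ S, i ∈ S → c S = d S) :
    eIndex c i = eIndex d i := by
  refine Finset.sum_congr rfl fun S hS => ?_
  rw [h S (Finset.mem_filter.mp hS).2]

/-- Swapping two authors who both belong to every group with nonzero credit leaves the
credit function unchanged. -/
theorem permCredit_swap_eq_self {N : Type*} [Fintype N] [DecidableEq N]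
    {c : Finset N → ℝ} {i j : N} (hi : ∀ S, c S ≠ 0 → i ∈ S) (hj : ∀ S, c S ≠ 0 → j ∈ S) :
    permCredit (Equiv.swap i j) c = c := by
  funext T
  rw [permCredit, Equiv.symm_swap]
  by_cases hT : i ∈ T ∧ j ∈ T
  · congr 1
    refine Finset.eq_of_subset_of_card_le ?_ ?_
    · intro x hx
      obtain ⟨y, hy, rfl⟩ := Finset.mem_image.mp hx
      rw [Equiv.swap_apply_def]
      split_ifs
      exacts [hT.2, hT.1, hy]
    · rw [Finset.card_image_of_injective _ (Equiv.injective _)]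
  · have h1 : c T = 0 := by
      by_contra h
      exact hT ⟨hi T h, hj T h⟩
    rw [h1]
    by_contra h
    apply hT
    obtain ⟨y, hy, hyi⟩ := Finset.mem_image.mp (hi _ h)
    obtain ⟨z, hz, hzj⟩ := Finset.mem_image.mp (hj _ h)
    rw [Equiv.swap_apply_eq_iff, Equiv.swap_apply_left] at hyi
    rw [Equiv.swap_apply_eq_iff, Equiv.swap_apply_right] at hzj
    subst hyi hzj
    exact ⟨hz, hy⟩

/-- Uniqueness: an index satisfying anonymity, monotonicity and efficiency must
be the e-index. -/
theorem index_eq_eIndex {N : Type*} [Fintype N] [DecidableEq N] [Nontrivial N]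
    (φ : (Finset N → ℝ) → N → ℝ)
    (hanon : Anonymity φ) (hmono : Monotonicity φ) (heff : Efficiency φ)
    (c : Finset N → ℝ) (hc : IsCredit c) (i : N) :
    φ c i = eIndex c i := by
  induction hn : (Finset.univ.filter fun S => c S ≠ 0).card using Nat.strong_induction_on
    generalizing c i with
  | _ n ih =>
    subst hn
    have outside (j : N) (hj : ¬ ∀ S, c S ≠ 0 → j ∈ S) : φ c j = eIndex c j := by
      push Not at hj
      obtain ⟨S, hS, hjS⟩ := hj
      have hd : IsCredit (Function.update c S 0) := by
        refine ⟨?_, fun T => ?_⟩ <;> rw [Function.update_apply] <;> split_ifs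
        exacts [rfl, hc.1, le_rfl, hc.2 T]
      have agree (T : Finset N) (hT : j ∈ T) : c T = Function.update c S 0 T := by
        rw [Function.update_of_ne]
        rintro rfl
        exact hjS hT
      rw [hmono.congr hc hd agree, eIndex_congr agree]
      refine ih _ (Finset.card_lt_card ?_) _ hd j rfl
      refine (Finset.ssubset_iff_of_subset ?_).mpr ⟨S, by simpa using hS, by simp⟩
      intro T
      simp only [Finset.mem_filter, Finset.mem_univ, true_and, Function.update_apply]
      split_ifs <;> simp
    by_cases hi : ∀ S, c S ≠ 0 → i ∈ S
    · have inside (j : N) (hj : ∀ S, c S ≠ 0 → j ∈ S) :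
          φ c j - eIndex c j = φ c i - eIndex c i := by
        have h1 := hanon (Equiv.swap i j) c hc i
        rw [permCredit_swap_eq_self hi hj, Equiv.swap_apply_left] at h1
        have h2 : eIndex c j = eIndex c i := by
          simp only [eIndex_eq_sum_ite]
          refine Finset.sum_congr rfl fun S _ => ?_
          by_cases hS : c S = 0
          · simp [hS]
          · rw [if_pos (hj S hS), if_pos (hi S hS)]
        rw [h1, h2]
      classical
      have total : ∑ j, (φ c j - eIndex c j) = 0 := by
        rw [Finset.sum_sub_distrib, heff c hc, efficiency_eIndex c hc, sub_self]
      have value (j : N) : φ c j - eIndex c j =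
          if ∀ S, c S ≠ 0 → j ∈ S then φ c i - eIndex c i else 0 := by
        split_ifs with hj
        exacts [inside j hj, sub_eq_zero.mpr (outside j hj)]
      rw [Finset.sum_congr rfl fun j _ => value j, ← Finset.sum_filter, Finset.sum_const,
        smul_eq_zero] at total
      refine sub_eq_zero.mp (total.resolve_left (Finset.card_ne_zero_of_mem (a := i) ?_))
      exact Finset.mem_filter.mpr ⟨Finset.mem_univ i, hi⟩
    · exact outside i hi
end
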